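/- If f is differentiable on an interval [a,b] not containing 0, then for all distinct x₁, x₂ in [a,b] there exists ξ strictly between x₁ and x₂ such that (x₁·f(x₂) − x₂·f(x₁))/(x₁ − x₂) = f(ξ) − ξ·f'(ξ). -/

import Mathlib

/-- Pompeiu's mean value theorem for ordered endpoints: the Cauchy mean value theorem applied to
`x ↦ f x / x` and `x ↦ x⁻¹`. -/
theorem exists_pompeiu_slope_of_lt {f : ℝ → ℝ} {u v : ℝ} (huv : u < v)
    (h0 : (0:ℝ) ∉ Set.Icc u v) (hfc : ContinuousOn f (Set.Icc u v))
    (hfd : ∀ x ∈ Set.Ioo u v, DifferentiableAt ℝ f x) :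
    ∃ ξ ∈ Set.Ioo u v, (u * f v - v * f u) / (u - v) = f ξ - ξ * deriv f ξ := by
  have hx0 : ∀ x ∈ Set.Icc u v, x ≠ 0 := fun x hx h => h0 (h ▸ hx)
  obtain ⟨ξ, hξ, h⟩ := exists_ratio_hasDerivAt_eq_ratio_slope (fun x => f x / x)
    (fun x => (deriv f x * x - f x * 1) / x ^ 2) huv (hfc.div continuousOn_id hx0)
    (fun x hx => (hfd x hx).hasDerivAt.div (hasDerivAt_id x)
      (hx0 x (Set.Ioo_subset_Icc_self hx)))
    (fun x => x⁻¹) (fun x => -(x ^ 2)⁻¹) (continuousOn_id.inv₀ hx0)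
    (fun x hx => hasDerivAt_inv (hx0 x (Set.Ioo_subset_Icc_self hx)))
  refine ⟨ξ, hξ, ?_⟩
  have hu := hx0 u (Set.left_mem_Icc.2 huv.le)
  have hv := hx0 v (Set.right_mem_Icc.2 huv.le)
  have hξ0 := hx0 ξ (Set.Ioo_subset_Icc_self hξ)
  have huv' : u - v ≠ 0 := sub_ne_zero.2 huv.ne
  rw [div_eq_iff huv']
  field_simp at h
  linarith

theorem pompeiu_mvt (f : ℝ → ℝ) (a b : ℝ) (hab : a < b)
    (h0 : (0:ℝ) ∉ Set.Icc a b)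
    (hf : ∀ x ∈ Set.Icc a b, DifferentiableAt ℝ f x)
    (x₁ x₂ : ℝ) (hx₁ : x₁ ∈ Set.Icc a b) (hx₂ : x₂ ∈ Set.Icc a b) (hne : x₁ ≠ x₂) :
    ∃ ξ ∈ Set.Ioo (min x₁ x₂) (max x₁ x₂),
      (x₁ * f x₂ - x₂ * f x₁) / (x₁ - x₂) = f ξ - ξ * deriv f ξ := by
  have key : ∀ u ∈ Set.Icc a b, ∀ v ∈ Set.Icc a b, u < v →
      ∃ ξ ∈ Set.Ioo u v, (u * f v - v * f u) / (u - v) = f ξ - ξ * deriv f ξ := by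
    intro u hu v hv huv
    have hsub : Set.Icc u v ⊆ Set.Icc a b := Set.Icc_subset_Icc hu.1 hv.2
    exact exists_pompeiu_slope_of_lt huv (fun h => h0 (hsub h))
      (fun x hx => (hf x (hsub hx)).continuousAt.continuousWithinAt)
      (fun x hx => hf x (hsub (Set.Ioo_subset_Icc_self hx)))
  rcases hne.lt_or_gt with h | h
  · rw [min_eq_left h.le, max_eq_right h.le]
    exact key x₁ hx₁ x₂ hx₂ h
  · rw [min_eq_right h.le, max_eq_left h.le, ← neg_div_neg_eq, neg_sub, neg_sub]
    exact key x₂ hx₂ x₁ hx₁ h
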